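/- arXiv:2506.04985 — 2 statements merged into one kernel-verified Lean document; each statement's English description precedes it below -/
import Mathlib

section
/- Let N ≥ 1, let s_1, …, s_N be nonzero reals and R_1, …, R_N ∈ SO(2) be 2×2 rotation matrices, and let T_k ∈ ℝ^{2N×2N} be the block-diagonal matrix whose n-th 2×2 block is s_n R_n and \bar{T}_k ∈ ℝ^{2N×2N} the block-diagonal matrix whose n-th 2×2 block is s_n^{-1} R_n. Let W_q, W_k ∈ ℝ^{d_in×2N} and define \tilde{W}_q = W_q \bar{T}_k and \tilde{W}_k = W_k T_k. Then for all row vectors x, y ∈ ℝ^{d_in}, all angle vectors Θ = (θ_1, …, θ_N), and all indices i, j ∈ ℕ: ⟨ f(x \tilde{W}_q, i), f(y \tilde{W}_k, j) ⟩ = ⟨ f(x W_q, i), f(y W_k, j) ⟩, where ⟨·,·⟩ is the Euclidean inner product. -/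
open Matrix

/-- The 2×2 planar rotation matrix `[[cos θ, sin θ], [−sin θ, cos θ]]`. -/
noncomputable def rot (θ : ℝ) : Matrix (Fin 2) (Fin 2) ℝ :=
  !![Real.cos θ, Real.sin θ; -Real.sin θ, Real.cos θ]

/-- The RoPE matrix `R^{2N}_{Θ,i}`: block-diagonal with n-th 2×2 block the
rotation by angle `i·θ_n`. -/
noncomputable def ropeM (N : ℕ) (Θ : Fin N → ℝ) (i : ℕ) :
    Matrix (Fin 2 × Fin N) (Fin 2 × Fin N) ℝ :=
  Matrix.blockDiagonal fun n => rot ((i : ℝ) * Θ n)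

/-- The transpose of a special orthogonal matrix is its adjugate. -/
theorem transpose_eq_adjugate_of_orthogonal {n : Type*} [Fintype n] [DecidableEq n]
    {A : Matrix n n ℝ} (hA : A * Aᵀ = 1) (hdet : A.det = 1) : Aᵀ = A.adjugate := by
  have h : A.adjugate * (A * Aᵀ) = A.adjugate := by rw [hA, mul_one]
  rwa [← Matrix.mul_assoc, adjugate_mul, hdet, one_smul, Matrix.one_mul] at h

theorem commute_rot_of_orthogonal {A : Matrix (Fin 2) (Fin 2) ℝ} (hA : A * Aᵀ = 1)
    (hdet : A.det = 1) (θ : ℝ) : Commute A (rot θ) := by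
  have h := transpose_eq_adjugate_of_orthogonal hA hdet
  rw [adjugate_fin_two] at h
  have h00 : A 0 0 = A 1 1 := by simpa using congrFun (congrFun h 0) 0
  have h10 : A 1 0 = -A 0 1 := by simpa using congrFun (congrFun h 0) 1
  ext a b
  fin_cases a <;> fin_cases b <;>
    simp [rot, Matrix.mul_apply, Fin.sum_univ_two, h00, h10] <;> ring

theorem scaled_conj_rot_mul_rot_transpose {A : Matrix (Fin 2) (Fin 2) ℝ} (hA : A * Aᵀ = 1)
    (hdet : A.det = 1) {c : ℝ} (hc : c ≠ 0) (α β : ℝ) :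
    (c⁻¹ • A * rot α) * (c • A * rot β)ᵀ = rot α * (rot β)ᵀ := by
  rw [smul_mul_assoc, smul_mul_assoc c, transpose_smul, smul_mul_smul_comm, inv_mul_cancel₀ hc,
    one_smul, (commute_rot_of_orthogonal hA hdet α).eq, (commute_rot_of_orthogonal hA hdet β).eq,
    transpose_mul, Matrix.mul_assoc, ← Matrix.mul_assoc A, hA, Matrix.one_mul]

theorem vecMul_dotProduct_vecMul_eq {m n : Type*} [Fintype m] [Fintype n]
    (u v : m → ℝ) (A B : Matrix m n ℝ) :
    (u ᵥ* A) ⬝ᵥ (v ᵥ* B) = (u ᵥ* (A * Bᵀ)) ⬝ᵥ v := by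
  rw [← mulVec_transpose B v, dotProduct_mulVec, vecMul_vecMul]

theorem stmt0 (N dIn : ℕ) (hN : 1 ≤ N)
    (s : Fin N → ℝ) (hs : ∀ n, s n ≠ 0)
    (R : Fin N → Matrix (Fin 2) (Fin 2) ℝ)
    (hRorth : ∀ n, R n * (R n)ᵀ = 1) (hRdet : ∀ n, (R n).det = 1)
    (Tk Tbark : Matrix (Fin 2 × Fin N) (Fin 2 × Fin N) ℝ)
    (hTk : Tk = Matrix.blockDiagonal fun n => s n • R n)
    (hTbark : Tbark = Matrix.blockDiagonal fun n => (s n)⁻¹ • R n)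
    (Wq Wk : Matrix (Fin dIn) (Fin 2 × Fin N) ℝ)
    (x y : Fin dIn → ℝ) (Θ : Fin N → ℝ) (i j : ℕ) :
    ((x ᵥ* (Wq * Tbark)) ᵥ* ropeM N Θ i) ⬝ᵥ ((y ᵥ* (Wk * Tk)) ᵥ* ropeM N Θ j)
      = ((x ᵥ* Wq) ᵥ* ropeM N Θ i) ⬝ᵥ ((y ᵥ* Wk) ᵥ* ropeM N Θ j) := by
  have key : (Tbark * ropeM N Θ i) * (Tk * ropeM N Θ j)ᵀ = ropeM N Θ i * (ropeM N Θ j)ᵀ := by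
    subst hTk hTbark
    simp only [ropeM, ← blockDiagonal_mul, blockDiagonal_transpose]
    congr 1
    funext n
    exact scaled_conj_rot_mul_rot_transpose (hRorth n) (hRdet n) (hs n) _ _
  rw [← vecMul_vecMul x, ← vecMul_vecMul y, vecMul_vecMul _ Tbark, vecMul_vecMul _ Tk,
    vecMul_dotProduct_vecMul_eq, key, ← vecMul_dotProduct_vecMul_eq]
end

section
/- Let d ≥ 1, N ≥ 1, and let g_1, …, g_N : ℝ^d → ℝ^d be arbitrary functions (the attention/MLP blocks as functions of their RMS-normalized inputs). Original network: let z_0 ∈ ℝ^d with z_0 ≠ 0 and z_n = z_{n−1} + g_n(RMSNorm(z_{n−1})) for n = 1, …, N, and assume z_n ≠ 0 for all n = 0, …, N. Transformed network: let \tilde{z}_0 = z_0 and s_0 = 1, and for n = 1, …, N set s_n = s_{n−1} / ‖\tilde{z}_{n−1}‖_R, \tilde{x}_n = \tilde{z}_{n−1} / ‖\tilde{z}_{n−1}‖_R, and \tilde{z}_n = \tilde{x}_n + s_n · g_n(\tilde{x}_n). Then for every n = 1, …, N: s_n = 1 / ‖z_{n−1}‖_R > 0 and \tilde{z}_n = s_n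 · z_n; in particular RMSNorm(\tilde{z}_N) = RMSNorm(z_N), so the pseudodynamic residual scaling preserves the network output after the final RMSNorm. -/
open Matrix

/-- Euclidean (ℓ₂) norm of a row vector in `ℝ^d`. -/
noncomputable def l2norm {d : ℕ} (x : Fin d → ℝ) : ℝ :=
  Real.sqrt (∑ i, x i ^ 2)

/-- The root-mean-square norm `‖x‖_R = ‖x‖₂ / √d`. -/
noncomputable def rmsN {d : ℕ} (x : Fin d → ℝ) : ℝ :=
  l2norm x / Real.sqrt d

/-- RMSNorm without learnable scale: `RMSNorm(x) = x / ‖x‖_R`. -/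
noncomputable def rmsNorm {d : ℕ} (x : Fin d → ℝ) : Fin d → ℝ :=
  (rmsN x)⁻¹ • x

theorem l2norm_smul {d : ℕ} (c : ℝ) (x : Fin d → ℝ) : l2norm (c • x) = |c| * l2norm x := by
  simp only [l2norm, Pi.smul_apply, smul_eq_mul, mul_pow, ← Finset.mul_sum]
  rw [Real.sqrt_mul (sq_nonneg c), Real.sqrt_sq_eq_abs]

theorem rmsN_smul {d : ℕ} (c : ℝ) (x : Fin d → ℝ) : rmsN (c • x) = |c| * rmsN x := by
  rw [rmsN, l2norm_smul, mul_div_assoc, rmsN]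

theorem l2norm_pos {d : ℕ} {x : Fin d → ℝ} (hx : x ≠ 0) : 0 < l2norm x := by
  obtain ⟨i, hi⟩ := Function.ne_iff.mp hx
  exact Real.sqrt_pos.mpr <| Finset.sum_pos' (fun j _ => sq_nonneg (x j))
    ⟨i, Finset.mem_univ i, sq_pos_of_ne_zero hi⟩

theorem rmsN_pos {d : ℕ} {x : Fin d → ℝ} (hx : x ≠ 0) : 0 < rmsN x := by
  obtain ⟨i, -⟩ := Function.ne_iff.mp hx
  have hd : (0 : ℝ) < d := by exact_mod_cast i.pos
  exact div_pos (l2norm_pos hx) (Real.sqrt_pos.mpr hd)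

theorem rmsNorm_smul {d : ℕ} {c : ℝ} (hc : 0 < c) (x : Fin d → ℝ) :
    rmsNorm (c • x) = rmsNorm x := by
  rw [rmsNorm, rmsN_smul, abs_of_pos hc, smul_smul, rmsNorm, mul_inv, mul_right_comm,
    inv_mul_cancel₀ hc.ne', one_mul]

theorem stmt11 (d N : ℕ) (hd : 1 ≤ d) (hN : 1 ≤ N)
    (g : ℕ → (Fin d → ℝ) → (Fin d → ℝ))
    -- original network
    (z : ℕ → Fin d → ℝ)
    (hzrec : ∀ n < N, z (n + 1) = z n + g (n + 1) (rmsNorm (z n)))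
    (hznz : ∀ n ≤ N, z n ≠ 0)
    -- transformed network
    (tz : ℕ → Fin d → ℝ) (s : ℕ → ℝ)
    (htz0 : tz 0 = z 0) (hs0 : s 0 = 1)
    (hsrec : ∀ n < N, s (n + 1) = s n / rmsN (tz n))
    (htzrec : ∀ n < N,
      tz (n + 1) = rmsNorm (tz n) + s (n + 1) • g (n + 1) (rmsNorm (tz n))) :
    (∀ n < N, s (n + 1) = 1 / rmsN (z n) ∧ 0 < s (n + 1) ∧
        tz (n + 1) = s (n + 1) • z (n + 1)) ∧
      rmsNorm (tz N) = rmsNorm (z N) := by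
  have step : ∀ n < N, 0 < s n → tz n = s n • z n →
      s (n + 1) = 1 / rmsN (z n) ∧ 0 < s (n + 1) ∧ tz (n + 1) = s (n + 1) • z (n + 1) := by
    intro n hn hs ht
    have hr := rmsN_pos (hznz n hn.le)
    have hs' : s (n + 1) = 1 / rmsN (z n) := by
      rw [hsrec n hn, ht, rmsN_smul, abs_of_pos hs]
      field_simp
    refine ⟨hs', hs' ▸ one_div_pos.mpr hr, ?_⟩
    rw [htzrec n hn, ht, rmsNorm_smul hs, hzrec n hn, smul_add, hs', one_div]
    rfl
  have inv : ∀ n ≤ N, 0 < s n ∧ tz n = s n • z n := by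
    intro n
    induction n with
    | zero => simp [hs0, htz0]
    | succ n ih =>
      intro hn
      obtain ⟨hs, ht⟩ := ih (by omega)
      exact (step n hn hs ht).2
  refine ⟨fun n hn => step n hn (inv n hn.le).1 (inv n hn.le).2, ?_⟩
  obtain ⟨hs, ht⟩ := inv N le_rfl
  rw [ht, rmsNorm_smul hs]
end
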